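/- arXiv:2110.05412 — 2 statements merged into one kernel-verified Lean document; each statement's English description precedes it below -/
import Mathlib

section
/- Free commutative monoids satisfy the Riesz refinement property: for any type A and s, t, u, v : Multiset A, s + t = u + v if and only if there exist x₁, x₂, y₁, y₂ : Multiset A such that s = x₁ + x₂, t = y₁ + y₂, x₁ + y₁ = u, and x₂ + y₂ = v. -/
/-- Free commutative monoids satisfy the Riesz refinement property. -/
theorem multiset_riesz_refinement (A : Type*) (s t u v : Multiset A) :
    s + t = u + v ↔
      ∃ x₁ x₂ y₁ y₂ : Multiset A,
        s = x₁ + x₂ ∧ t = y₁ + y₂ ∧ x₁ + y₁ = u ∧ x₂ + y₂ = v := by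
  classical
  constructor
  · intro h
    have hcount (a : A) : s.count a + t.count a = u.count a + v.count a := by
      rw [← Multiset.count_add, h, Multiset.count_add]
    refine ⟨s ∩ u, s - u, u - s, t - (u - s), ?_, ?_, ?_, ?_⟩ <;>
    · ext a
      have := hcount a
      simp only [Multiset.count_add, Multiset.count_sub, Multiset.count_inter]
      omega
  · rintro ⟨x₁, x₂, y₁, y₂, rfl, rfl, rfl, rfl⟩
    exact add_add_add_comm x₁ x₂ y₁ y₂
end

section
/- Soundness and completeness of the commutation deduction system for multiset equality: for any type A and lists as, bs : List A, R as bs holds if and only if as is a permutation of bs (List.Perm as bs); equivalently, if and only if as and bs determine the same multiset. -/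
/-- The commutation deduction system for multiset equality. -/
inductive R {A : Type*} : List A → List A → Prop
  | nil : R [] []
  | cons_cong {a b : A} {as bs : List A} : a = b → R as bs → R (a :: as) (b :: bs)
  | comm {a b : A} {as bs cs : List A} :
      R as (b :: cs) → R (a :: cs) bs → R (a :: as) (b :: bs)

theorem R.perm {A : Type*} {as bs : List A} (h : R as bs) : as.Perm bs := by
  induction h with
  | nil => exact .nil
  | cons_cong hab _ ih => exact hab ▸ ih.cons _
  | comm _ _ ih₁ ih₂ => exact (ih₁.cons _).trans ((List.Perm.swap _ _ _).trans (ih₂.cons _))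

theorem List.Perm.toR {A : Type*} : ∀ {as bs : List A}, as.Perm bs → R as bs
  | [], bs, h => by
    rw [List.nil_perm.mp h]
    exact .nil
  | a :: as, [], h => absurd h.length_eq (by simp)
  | a :: as, b :: bs, h => by
    rcases List.mem_cons.mp (h.mem_iff.mpr List.mem_cons_self) with rfl | hb
    · exact .cons_cong rfl (List.Perm.toR h.cons_inv)
    · obtain ⟨s, t, hst⟩ := List.append_of_mem hb
      have has : as.Perm (b :: (s ++ t)) := hst ▸ List.perm_middle
      have hbs : (a :: (s ++ t)).Perm bs :=
        (((List.Perm.swap _ _ _).trans (has.symm.cons a)).trans h).cons_inv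
      exact .comm (List.Perm.toR has) (List.Perm.toR hbs)
termination_by as => as.length
decreasing_by all_goals simp_all

/-- Soundness and completeness of the commutation deduction system: two lists are
related by `R` iff they are permutations of each other, equivalently iff they
determine the same multiset. -/
theorem R_iff_perm_iff_multiset_eq (A : Type*) (as bs : List A) :
    (R as bs ↔ List.Perm as bs) ∧ (R as bs ↔ (as : Multiset A) = (bs : Multiset A)) := by
  have h : R as bs ↔ as.Perm bs := ⟨R.perm, List.Perm.toR⟩
  exact ⟨h, h.trans Multiset.coe_eq_coe.symm⟩
end
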